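/- arXiv:1910.06033 — 2 statements merged into one kernel-verified Lean document; each statement's English description precedes it below -/
import Mathlib

section
/- Any subset Ω ⊆ ℝⁿ which is compact, contractible, and strictly locally contractible is a retract of a compact ball in ℝⁿ, and hence has the fixed-point property: every continuous map f : Ω → Ω has a fixed point. -/
open Metric Set

noncomputable section

abbrev Euc (n : ℕ) : Type := EuclideanSpace ℝ (Fin n)

/-- `Ω` is strictly locally contractible: every open neighborhood `U` of every
point `x ∈ Ω` contains a contractible open neighborhood `V` of `x` (in the
subspace topology of `Ω`). -/
def StrictlyLocallyContractible {n : ℕ} (Ω : Set (Euc n)) : Prop :=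
  ∀ x : Ω, ∀ U : Set Ω, IsOpen U → x ∈ U →
    ∃ V : Set Ω, IsOpen V ∧ x ∈ V ∧ V ⊆ U ∧ ContractibleSpace V

theorem det_one_add_eq_sum_basis {E : Type*} [AddCommGroup E] [Module ℝ E] [FiniteDimensional ℝ E]
    (v : ℕ → ℝ) (hv : Function.Injective v) (A : E →ₗ[ℝ] E) :
    LinearMap.det (1 + A) = ∑ i ∈ Finset.range (Module.finrank ℝ E + 1),
      LinearMap.det (1 + v i • A) *
        (Lagrange.basis (Finset.range (Module.finrank ℝ E + 1)) v i).eval 1 := by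
  let b := Module.finBasis ℝ E
  let M := LinearMap.toMatrix b b A
  let p : Polynomial ℝ := Matrix.det ((Polynomial.X : Polynomial ℝ) • M.map Polynomial.C +
    (1 : Matrix _ _ ℝ).map Polynomial.C)
  have heval : ∀ t : ℝ, p.eval t = LinearMap.det (1 + t • A) := by
    intro t
    rw [← LinearMap.det_toMatrix b]
    simp only [p]
    rw [← Polynomial.coe_evalRingHom, RingHom.map_det]
    congr 1
    ext i j
    simp [M, Matrix.one_apply, apply_ite, add_comm, LinearMap.toMatrix_one]
    split_ifs <;> ring
  have hdeg : p.degree < (Finset.range (Module.finrank ℝ E + 1)).card := by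
    rw [Finset.card_range]
    have := Polynomial.natDegree_det_X_add_C_le M 1
    rw [Fintype.card_fin] at this
    exact lt_of_le_of_lt Polynomial.degree_le_natDegree (by exact_mod_cast Nat.lt_succ_of_le this)
  have h := congrArg (Polynomial.eval 1) (Lagrange.eq_interpolate hv.injOn hdeg)
  rw [heval, one_smul, Lagrange.interpolate_apply, Polynomial.eval_finsetSum] at h
  rw [h]
  simp [heval]

theorem det_one_add_smul_pos {E : Type*} [NormedAddCommGroup E] [NormedSpace ℝ E]
    [FiniteDimensional ℝ E] {A : E →L[ℝ] E} {L t : ℝ} (hA : ‖A‖ ≤ L) (ht : 0 ≤ t) (htL : t * L < 1) :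
    0 < LinearMap.det (1 + t • (A : E →ₗ[ℝ] E)) := by
  have hne : ∀ s ∈ Icc 0 t, LinearMap.det (1 + s • (A : E →ₗ[ℝ] E)) ≠ 0 := by
    intro s hs
    rw [Ne, LinearMap.det_eq_zero_iff_ker_ne_bot, not_not, LinearMap.ker_eq_bot']
    intro m hm
    by_contra hm0
    have h1 : m = -(s • A m) := by
      rw [eq_neg_iff_add_eq_zero]
      simpa using hm
    have h2 : ‖m‖ ≤ s * (L * ‖m‖) := by
      conv_lhs => rw [h1, norm_neg, norm_smul, Real.norm_of_nonneg hs.1]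
      exact mul_le_mul_of_nonneg_left (A.le_of_opNorm_le hA m) hs.1
    have h3 : s * L ≤ t * L := mul_le_mul_of_nonneg_right hs.2 ((norm_nonneg _).trans hA)
    have h4 := norm_pos_iff.2 hm0
    nlinarith
  have hcont : Continuous fun s : ℝ => LinearMap.det (1 + s • (A : E →ₗ[ℝ] E)) := by
    have : (fun s : ℝ => LinearMap.det (1 + s • (A : E →ₗ[ℝ] E))) =
        fun s : ℝ => (1 + s • A : E →L[ℝ] E).det := by
      ext s; rfl
    rw [this]
    exact ContinuousLinearMap.continuous_det.comp (by fun_prop)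
  by_contra hle
  obtain ⟨s, hs, hs0⟩ := intermediate_value_Icc' ht hcont.continuousOn
    (show (0 : ℝ) ∈ Icc _ _ from ⟨not_lt.1 hle, by simp⟩)
  exact hne s hs hs0

/-- A map which is Lipschitz on a ball and vanishes outside its interior is globally Lipschitz. -/
theorem LipschitzOnWith.lipschitzWith_of_eq_zero {E F : Type*} [NormedAddCommGroup E]
    [NormedSpace ℝ E] [NormedAddCommGroup F] {k : E → F} {K : NNReal} {ρ : ℝ}
    (hk : LipschitzOnWith K k (closedBall 0 ρ)) (h0 : ∀ x, ρ ≤ ‖x‖ → k x = 0) :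
    LipschitzWith K k := by
  have key : ∀ x y : E, ‖x‖ ≤ ρ → ρ ≤ ‖y‖ → dist (k x) (k y) ≤ K * dist x y := by
    intro x y hx hy
    have hc : Continuous fun t : ℝ => ‖AffineMap.lineMap x y t‖ := by
      simp only [AffineMap.lineMap_apply_module]; fun_prop
    obtain ⟨t, ht, hz⟩ := intermediate_value_Icc zero_le_one hc.continuousOn
      (show ρ ∈ Icc _ _ from ⟨by simpa using hx, by simpa using hy⟩)
    simp only at hz
    set z := AffineMap.lineMap x y t
    rw [h0 y hy, ← h0 z hz.ge]
    refine (hk.dist_le_mul x (by simpa using hx) z (by simp [hz])).trans ?_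
    gcongr
    rw [dist_left_lineMap, Real.norm_of_nonneg ht.1]
    exact mul_le_of_le_one_left dist_nonneg ht.2
  refine LipschitzWith.of_dist_le_mul fun x y => ?_
  rcases le_total ‖x‖ ρ with hx | hx <;> rcases le_total ‖y‖ ρ with hy | hy
  · exact hk.dist_le_mul x (by simpa using hx) y (by simpa using hy)
  · exact key x y hx hy
  · rw [dist_comm, dist_comm x]; exact key y x hy hx
  · rw [h0 x hx, h0 y hy, dist_self]; positivity

theorem LipschitzWith.bijective_id_add_smul {E : Type*} [NormedAddCommGroup E]
    [NormedSpace ℝ E] [CompleteSpace E] {k : E → E} {L : NNReal} (hk : LipschitzWith L k)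
    {t : ℝ} (ht : 0 ≤ t) (htL : t * L < 1) :
    Function.Bijective fun x => x + t • k x := by
  let c : NNReal := ⟨t, ht⟩ * L
  have hc : (c : ℝ) < 1 := htL
  have happ : ApproximatesLinearOn (fun x => x + t • k x)
      ((ContinuousLinearEquiv.refl ℝ E : E ≃L[ℝ] E) : E →L[ℝ] E) univ c := by
    intro x _ y _
    have : x + t • k x - (y + t • k y) -
        ((ContinuousLinearEquiv.refl ℝ E : E ≃L[ℝ] E) : E →L[ℝ] E) (x - y) =
        t • (k x - k y) := by
      simp [smul_sub]; abel
    rw [this, norm_smul, Real.norm_of_nonneg ht]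
    have := hk.norm_sub_le x y
    show _ ≤ t * L * _
    rw [mul_assoc]
    gcongr
  rcases subsingleton_or_nontrivial E with hE | hE
  · exact (happ.toHomeomorph _ (Or.inl hE)).bijective
  · refine (happ.toHomeomorph _ (Or.inr ?_)).bijective
    have : ‖((ContinuousLinearEquiv.refl ℝ E : E ≃L[ℝ] E).symm : E →L[ℝ] E)‖₊ = 1 := by
      ext
      simp
    rw [this, inv_one]
    exact_mod_cast hc

open MeasureTheory in
theorem integral_det_one_add_smul {E : Type*} [NormedAddCommGroup E] [NormedSpace ℝ E]
    [FiniteDimensional ℝ E] [MeasurableSpace E] [BorelSpace E] (μ : Measure E)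
    [μ.IsAddHaarMeasure] {k : E → E} {k' : E → E →L[ℝ] E} {L : NNReal} {ρ : ℝ}
    (hk : LipschitzWith L k) (h0 : ∀ x, ρ ≤ ‖x‖ → k x = 0)
    (hk' : ∀ x ∈ ball 0 ρ, HasFDerivAt k (k' x) x) {t : ℝ} (ht : 0 ≤ t) (htL : t * L < 1) :
    IntegrableOn (fun x => LinearMap.det (1 + t • (k' x : E →ₗ[ℝ] E))) (ball 0 ρ) μ ∧
    ∫ x in ball 0 ρ, LinearMap.det (1 + t • (k' x : E →ₗ[ℝ] E)) ∂μ = μ.real (ball 0 ρ) := by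
  have hbij := hk.bijective_id_add_smul ht htL
  have himg : (fun x => x + t • k x) '' ball 0 ρ = ball 0 ρ := by
    ext y
    constructor
    · rintro ⟨x, hx, rfl⟩
      by_contra hy
      rw [mem_ball_zero_iff, not_lt] at hy
      have : x + t • k x = x := hbij.1 (by simp [h0 _ hy])
      simp only [this] at hy
      exact absurd (mem_ball_zero_iff.1 hx) (not_lt.2 hy)
    · intro hy
      obtain ⟨x, rfl⟩ := hbij.2 y
      refine ⟨x, ?_, rfl⟩
      by_contra hx
      rw [mem_ball_zero_iff, not_lt] at hx
      simp only [h0 x hx, smul_zero, add_zero] at hy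
      exact absurd (mem_ball_zero_iff.1 hy) (not_lt.2 hx)
  have hder : ∀ x ∈ ball (0 : E) ρ, HasFDerivWithinAt (fun x => x + t • k x)
      (ContinuousLinearMap.id ℝ E + t • k' x) (ball 0 ρ) x := fun x hx =>
    ((hasFDerivAt_id x).add ((hk' x hx).const_smul t)).hasFDerivWithinAt
  have hdet : ∀ x ∈ ball (0 : E) ρ, |(ContinuousLinearMap.id ℝ E + t • k' x).det| • (1 : ℝ) =
      LinearMap.det (1 + t • (k' x : E →ₗ[ℝ] E)) := by
    intro x hx
    have := det_one_add_smul_pos ((hk' x hx).le_of_lipschitz hk) ht htL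
    rw [smul_eq_mul, mul_one]
    exact abs_of_pos this
  constructor
  · rw [← integrableOn_congr_fun hdet measurableSet_ball,
      ← integrableOn_image_iff_integrableOn_abs_det_fderiv_smul μ measurableSet_ball hder
        hbij.1.injOn (fun _ => (1 : ℝ)), himg]
    exact integrableOn_const measure_ball_lt_top.ne
  · rw [← setIntegral_congr_fun measurableSet_ball hdet,
      ← integral_image_eq_integral_abs_det_fderiv_smul μ measurableSet_ball hder
        hbij.1.injOn (fun _ => (1 : ℝ)), himg]
    simp

/-- The no-retraction theorem, for `C¹` maps which are the identity away from a ball. -/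
theorem exists_eq_zero_of_eq_id_outside_ball {E : Type*} [NormedAddCommGroup E]
    [InnerProductSpace ℝ E] [FiniteDimensional ℝ E] {φ : E → E} (hφ : ContDiff ℝ 1 φ)
    {ρ : ℝ} (hρ : 0 < ρ) (hid : ∀ x, ρ ≤ ‖x‖ → φ x = x) : ∃ x, φ x = 0 := by
  by_contra! hne
  borelize E
  let μ : MeasureTheory.Measure E := MeasureTheory.Measure.addHaar
  let F : E → E := fun x => (ρ / ‖φ x‖) • φ x
  have hF : ContDiff ℝ 1 F :=
    (contDiff_const.div (hφ.norm ℝ hne) fun x => norm_ne_zero_iff.2 (hne x)).smul hφ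
  have hFn : ∀ x, ‖F x‖ = ρ := fun x => by
    have := norm_ne_zero_iff.2 (hne x)
    simp only [F, norm_smul, norm_div, norm_norm, Real.norm_of_nonneg hρ.le]
    field_simp
  have hFD : ∀ x, HasFDerivAt F (fderiv ℝ F x) x := fun x =>
    (hF.differentiable one_ne_zero x).hasFDerivAt
  have hdet0 : ∀ x, LinearMap.det (fderiv ℝ F x : E →ₗ[ℝ] E) = 0 := by
    intro x
    have horth : ∀ v, inner ℝ (F x) (fderiv ℝ F x v) = 0 := by
      intro v
      have h1 := (hFD x).norm_sq
      have h2 : (fun y => ‖F y‖ ^ 2) = fun _ => ρ ^ 2 := by ext y; rw [hFn]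
      rw [h2] at h1
      have h3 := h1.unique (hasFDerivAt_const (ρ ^ 2) x)
      simpa using DFunLike.congr_fun h3 v
    rw [LinearMap.det_eq_zero_iff_ker_ne_bot, Ne, LinearMap.ker_eq_bot]
    intro hinj
    obtain ⟨v, hv⟩ := (LinearMap.injective_iff_surjective.1 hinj) (F x)
    have := horth v
    rw [ContinuousLinearMap.coe_coe] at hv
    rw [hv, real_inner_self_eq_norm_sq, hFn] at this
    exact hρ.ne' (by simpa using this)
  let k0 : E → E := fun x => F x - x
  have hk0 : ContDiff ℝ 1 k0 := hF.sub contDiff_id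
  obtain ⟨L, hL⟩ := hk0.contDiffOn.exists_lipschitzOnWith one_ne_zero
    (convex_closedBall (0 : E) ρ) (isCompact_closedBall 0 ρ)
  let k : E → E := (closedBall (0 : E) ρ).indicator k0
  have h0 : ∀ x, ρ ≤ ‖x‖ → k x = 0 := by
    intro x hx
    by_cases hx' : x ∈ closedBall (0 : E) ρ
    · have hxρ : ‖x‖ = ρ := le_antisymm (by simpa using hx') hx
      simp only [k, indicator_of_mem hx', k0, F, hid x hx, hxρ]
      rw [div_self hρ.ne', one_smul, sub_self]
    · exact indicator_of_notMem hx' _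
  have hk : LipschitzWith L k := by
    refine LipschitzOnWith.lipschitzWith_of_eq_zero (ρ := ρ) ?_ h0
    intro x hx y hy
    simp only [k, indicator_of_mem hx, indicator_of_mem hy]
    exact hL hx hy
  have hk' : ∀ x ∈ ball 0 ρ,
      HasFDerivAt k (fderiv ℝ F x - ContinuousLinearMap.id ℝ E) x := by
    intro x hx
    refine ((hFD x).sub (hasFDerivAt_id x)).congr_of_eventuallyEq ?_
    filter_upwards [isOpen_ball.mem_nhds hx] with y hy
    exact indicator_of_mem (ball_subset_closedBall hy) _
  set n := Module.finrank ℝ E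
  let τ : ℝ := 1 / ((n + 1) * (L + 1))
  have hτ : 0 < τ := by positivity
  let v : ℕ → ℝ := fun i => τ * i
  have hv : Function.Injective v := fun i j hij => by
    have := mul_left_cancel₀ hτ.ne' hij
    exact_mod_cast this
  have hv0 : ∀ i, 0 ≤ v i := fun i => by positivity
  have hvL : ∀ i ∈ Finset.range (n + 1), v i * L < 1 := by
    intro i hi
    have hi' : (i : ℝ) < n + 1 := by exact_mod_cast Finset.mem_range.1 hi
    have : v i * L = (i * L) / ((n + 1) * (L + 1)) := by simp only [v, τ]; ring
    rw [this, div_lt_one (by positivity)]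
    have hL0 : (0 : ℝ) ≤ L := L.2
    nlinarith
  have hI := fun i hi => integral_det_one_add_smul μ hk h0 hk' (hv0 i) (hvL i hi)
  have hsum : ∀ x, ∑ i ∈ Finset.range (n + 1),
      LinearMap.det (1 + v i •
        ((fderiv ℝ F x - ContinuousLinearMap.id ℝ E : E →L[ℝ] E) : E →ₗ[ℝ] E)) *
        (Lagrange.basis (Finset.range (n + 1)) v i).eval 1 = 0 := by
    intro x
    rw [← det_one_add_eq_sum_basis v hv, ← hdet0 x]
    congr 1
    ext y
    simp
  have hvol : ∑ i ∈ Finset.range (n + 1), μ.real (ball 0 ρ) *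
      (Lagrange.basis (Finset.range (n + 1)) v i).eval 1 = 0 := by
    calc _ = ∑ i ∈ Finset.range (n + 1), ∫ x in ball 0 ρ, LinearMap.det (1 + v i •
        ((fderiv ℝ F x - ContinuousLinearMap.id ℝ E : E →L[ℝ] E) : E →ₗ[ℝ] E)) *
        (Lagrange.basis (Finset.range (n + 1)) v i).eval 1 ∂μ := by
          refine Finset.sum_congr rfl fun i hi => ?_
          rw [MeasureTheory.integral_mul_const, (hI i hi).2]
      _ = ∫ x in ball 0 ρ, ∑ i ∈ Finset.range (n + 1), LinearMap.det (1 + v i •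
        ((fderiv ℝ F x - ContinuousLinearMap.id ℝ E : E →L[ℝ] E) : E →ₗ[ℝ] E)) *
        (Lagrange.basis (Finset.range (n + 1)) v i).eval 1 ∂μ :=
          (MeasureTheory.integral_finsetSum _ fun i hi => (hI i hi).1.mul_const _).symm
      _ = 0 := by simp only [hsum, MeasureTheory.integral_zero]
  rw [← Finset.mul_sum, ← Polynomial.eval_finsetSum,
    Lagrange.sum_basis hv.injOn ⟨0, by simp⟩, Polynomial.eval_one, mul_one] at hvol
  exact (ENNReal.toReal_pos (Metric.measure_ball_pos μ (0 : E) hρ).ne'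
    MeasureTheory.measure_ball_lt_top.ne).ne' hvol

/-- **Brouwer's fixed point theorem**, for bounded continuous self-maps of a Euclidean space. -/
theorem exists_fixedPoint_of_continuous_of_bounded {E : Type*} [NormedAddCommGroup E]
    [InnerProductSpace ℝ E] [FiniteDimensional ℝ E] {g : E → E} (hg : Continuous g)
    {R : ℝ} (hR : ∀ x, ‖g x‖ ≤ R) : ∃ x, g x = x := by
  by_contra! hne
  have hR0 : 0 ≤ R := (norm_nonneg _).trans (hR 0)
  obtain ⟨ε, hε, hεle⟩ : ∃ ε > 0, ∀ x ∈ closedBall (0 : E) (R + 2), ε ≤ ‖g x - x‖ := by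
    obtain ⟨x₀, -, hx₀⟩ := (isCompact_closedBall (0 : E) (R + 2)).exists_isMinOn
      ⟨0, by simp; linarith⟩ (f := fun x => ‖g x - x‖) (by fun_prop)
    exact ⟨_, norm_pos_iff.2 (sub_ne_zero.2 (hne x₀)), fun x hx => hx₀ hx⟩
  obtain ⟨p, hp, hpg, -⟩ := hg.exists_contDiff_approx 1 (ε := fun _ => min ε 1) continuous_const
    (fun _ => by positivity)
  have hpR : ∀ x, ‖p x‖ < R + 1 := fun x => by
    have h1 := (hpg x).trans_le (min_le_right _ _)
    rw [dist_eq_norm] at h1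
    have h2 := norm_le_norm_add_norm_sub (g x) (p x)
    have h3 := norm_sub_rev (g x) (p x)
    linarith [hR x]
  have hpx : ∀ x, ‖x‖ ≤ R + 2 → p x ≠ x := fun x hx h => by
    have h1 := (hpg x).trans_le (min_le_left _ _)
    rw [h, dist_comm, dist_eq_norm] at h1
    exact absurd (hεle x (by simpa using hx)) (not_le.2 h1)
  let χ : ContDiffBump (0 : E) := ⟨R + 2, R + 3, by linarith, by linarith⟩
  obtain ⟨x, hx⟩ := exists_eq_zero_of_eq_id_outside_ball (φ := fun x => x - χ x • p x)
    (contDiff_id.sub (χ.contDiff.smul hp)) (ρ := R + 3) (by linarith) (fun x hx => by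
      rw [χ.zero_of_le_dist (by simpa using hx), zero_smul, sub_zero])
  rw [sub_eq_zero] at hx
  have hxR : ‖x‖ ≤ R + 2 := by
    rw [hx, norm_smul, Real.norm_of_nonneg χ.nonneg]
    have := mul_le_of_le_one_left (norm_nonneg (p x)) (χ.le_one (x := x))
    linarith [hpR x]
  rw [χ.one_of_mem_closedBall (by simpa using hxR), one_smul] at hx
  exact hpx x hxR hx.symm

/-- A map into a contractible set `V`, defined on the part of an open set `P` lying in an open
set `W`, extends to all of `P` after shrinking `W`, the shrinking being measured by `u`. -/
theorem exists_extension_of_contractibleSpace {Y T : Type*} [TopologicalSpace Y]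
    [TopologicalSpace T] {V : Set T} (hV : ContractibleSpace V) {P W : Set Y} (hP : IsOpen P)
    (hW : IsOpen W) {u : Y → ℝ} (hu : ContinuousOn u P) (hu1 : ∀ x ∈ P, x ∉ W → u x = 1)
    {f : Y → T} (hf : ContinuousOn f (P ∩ W)) (hfV : MapsTo f (P ∩ W) V) :
    ∃ g : Y → T, ContinuousOn g P ∧ MapsTo g P V ∧ ∀ x ∈ P, u x ≤ 1 / 3 → g x = f x := by
  classical
  obtain ⟨c, ⟨H⟩⟩ := id_nullhomotopic V
  let s : Y → unitInterval := fun x => projIcc 0 1 zero_le_one (3 * u x - 1)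
  let g : Y → V := fun x => if h : x ∈ P ∩ W then H (s x, ⟨f x, hfV h⟩) else c
  have hs : ContinuousOn s P := continuous_projIcc.comp_continuousOn (by fun_prop)
  have hg1 : ∀ x ∈ P, 2 / 3 < u x → g x = c := by
    intro x hx hux
    by_cases h : x ∈ P ∩ W
    · have : s x = 1 := projIcc_of_right_le _ (by linarith)
      simp only [g, dif_pos h, this]
      simp
    · simp only [g, dif_neg h]
  refine ⟨fun x => g x, ?_, fun x _ => (g x).2, fun x hx hux => ?_⟩
  · refine continuous_subtype_val.comp_continuousOn ?_
    have hopen : IsOpen (P ∩ u ⁻¹' Ioi (2 / 3)) := hu.isOpen_inter_preimage hP isOpen_Ioi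
    have h1 : ContinuousOn g (P ∩ W) := by
      rw [continuousOn_iff_continuous_domRestrict]
      have : (P ∩ W).domRestrict g = fun x : ↥(P ∩ W) => H (s x, ⟨f x, hfV x.2⟩) := by
        ext x
        simp [g, x.2.1, x.2.2]
      rw [this]
      have := continuousOn_iff_continuous_domRestrict.1 (hs.mono (inter_subset_left (t := W)))
      have hf' := continuousOn_iff_continuous_domRestrict.1 hf
      exact H.continuous.comp (this.prodMk (hf'.subtype_mk _))
    have h2 : ContinuousOn g (P ∩ u ⁻¹' Ioi (2 / 3)) :=
      (continuousOn_const (c := c)).congr fun x hx => hg1 x hx.1 hx.2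
    refine (h1.union_of_isOpen h2 (hP.inter hW) hopen).mono fun x hx => ?_
    by_cases hxW : x ∈ W
    · exact Or.inl ⟨hx, hxW⟩
    · exact Or.inr ⟨hx, by rw [mem_preimage, hu1 x hx hxW, mem_Ioi]; norm_num⟩
  · have hxW : x ∈ W := by
      by_contra h
      rw [hu1 x hx h] at hux
      norm_num at hux
    have : s x = 0 := projIcc_of_le_left _ (by linarith)
    simp [g, hx, hxW, this]

theorem exists_continuousOn_urysohn {Y : Type*} [MetricSpace Y] {X W G : Set Y}
    (hW : IsOpen W) (hG : IsOpen G) (hcov : X ⊆ W ∪ G) :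
    ∃ u : Y → ℝ, ContinuousOn u X ∧ (∀ x ∈ X, x ∉ G → u x = 0) ∧ ∀ x ∈ X, x ∉ W → u x = 1 := by
  classical
  obtain ⟨u, hu0, hu1, -⟩ := exists_continuous_zero_one_of_isClosed
    (s := ((↑) : X → Y) ⁻¹' Gᶜ) (t := ((↑) : X → Y) ⁻¹' Wᶜ)
    (hG.isClosed_compl.preimage continuous_subtype_val)
    (hW.isClosed_compl.preimage continuous_subtype_val)
    (disjoint_left.2 fun x hxG hxW => (hcov x.2).elim hxW hxG)
  refine ⟨fun x => if h : x ∈ X then u ⟨x, h⟩ else 0, ?_, fun x hx hxG => ?_, fun x hx hxW => ?_⟩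
  · rw [continuousOn_iff_continuous_domRestrict]
    convert u.continuous using 1
    ext x
    simp
  · simpa [hx] using hu0 (show (⟨x, hx⟩ : X) ∈ _ from hxG)
  · simpa [hx] using hu1 (show (⟨x, hx⟩ : X) ∈ _ from hxW)

/-- Among the contractible sets containing `S`, one whose distance from `p` is almost minimal. -/
theorem exists_almost_minimal_contractible {Y : Type*} [MetricSpace Y] {Ω : Set Y}
    (hb : Bornology.IsBounded Ω) (hcontr : ContractibleSpace Ω) (S : Set Ω) (p : Y)
    {η : ℝ} (hη : 0 < η) :
    ∃ V : Set Ω, ContractibleSpace V ∧ S ⊆ V ∧ ∀ V' : Set Ω, ContractibleSpace V' → S ⊆ V' →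
      ∀ ε > 0, (∀ v ∈ V', dist (v : Y) p < ε) → ∀ v ∈ V, dist (v : Y) p < ε + η := by
  let A : Set ℝ := {ε | 0 < ε ∧ ∃ V : Set Ω, ContractibleSpace V ∧ S ⊆ V ∧
    ∀ v ∈ V, dist (v : Y) p < ε}
  have hne : A.Nonempty := by
    obtain ⟨r, hr0, hr⟩ := hb.subset_ball_lt 0 p
    exact ⟨r, hr0, univ, (Homeomorph.Set.univ Ω).contractibleSpace, subset_univ _,
      fun v _ => hr v.2⟩
  have hbd : BddBelow A := ⟨0, fun _ h => h.1.le⟩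
  obtain ⟨ε, ⟨-, V, hV, hSV, hVε⟩, hlt⟩ := exists_lt_of_csInf_lt hne (lt_add_of_pos_right _ hη)
  refine ⟨V, hV, hSV, fun V' hV' hSV' ε' hε' h v hv => (hVε v hv).trans (hlt.trans_le ?_)⟩
  gcongr
  exact csInf_le hbd ⟨hε', V', hV', hSV', h⟩

/-- Enlarging the domain of a partial retraction by a disjoint family of open sets which shrink
when they approach `Ω`. -/
theorem exists_extension_of_disjoint_family {Y : Type*} [MetricSpace Y] {Ω : Set Y}
    (hcl : IsClosed Ω) (hb : Bornology.IsBounded Ω) (hcontr : ContractibleSpace Ω)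
    (hslc : ∀ x : Ω, ∀ U : Set Ω, IsOpen U → x ∈ U →
      ∃ V : Set Ω, IsOpen V ∧ x ∈ V ∧ V ⊆ U ∧ ContractibleSpace V)
    {ι : Type*} {P : ι → Set Y} (hPo : ∀ i, IsOpen (P i))
    (hdisj : ∀ i j x, x ∈ P i → x ∈ P j → i = j) (hPΩ : ∀ i, P i ⊆ Ωᶜ)
    (hsmall : ∀ a ∈ Ω, ∀ ε > 0, ∃ δ > 0, ∀ i, ∀ x ∈ P i, dist x a < δ →
      ∀ y ∈ P i, dist y a < ε)
    {W R : Set Y} (hW : IsOpen W) (hR : IsOpen R) (hcov : Ωᶜ ⊆ W ∪ ((⋃ i, P i) ∪ R))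
    {f : Y → Ω} (hf : ContinuousOn f (W ∪ Ω)) (hid : ∀ a : Ω, f a = a) :
    ∃ (W₁ : Set Y) (f₁ : Y → Ω), IsOpen W₁ ∧ Ωᶜ ⊆ W₁ ∪ R ∧
      ContinuousOn f₁ (W₁ ∪ Ω) ∧ ∀ a : Ω, f₁ a = a := by
  classical
  have hΩne : Ω.Nonempty := by
    obtain ⟨x⟩ := (inferInstance : Nonempty Ω)
    exact ⟨x, x.2⟩
  obtain ⟨u, hu, hu0, hu1⟩ := exists_continuousOn_urysohn hW
    ((isOpen_iUnion hPo).union hR) hcov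
  have hchoice : ∀ i, ∃ g : Y → Ω, ContinuousOn g (P i) ∧
      (∀ x ∈ P i, u x ≤ 1 / 3 → g x = f x) ∧
      ∀ V' : Set Ω, ContractibleSpace V' → MapsTo f (P i ∩ W) V' → ∀ a ∈ Ω, ∀ ε > 0,
        (∀ v ∈ V', dist (v : Y) a < ε) → (∀ y ∈ P i, dist y a < ε) →
        ∀ x ∈ P i, dist (g x : Y) a < 4 * ε := by
    intro i
    rcases (P i).eq_empty_or_nonempty with he | ⟨p, hp⟩
    · exact ⟨f, by simp [he], by simp [he], by simp [he]⟩
    have hη : 0 < infDist p Ω := (hcl.notMem_iff_infDist_pos hΩne).1 (hPΩ i hp)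
    obtain ⟨V, hV, hSV, hVmin⟩ :=
      exists_almost_minimal_contractible hb hcontr (f '' (P i ∩ W)) p hη
    obtain ⟨g, hg, hgV, hgf⟩ := exists_extension_of_contractibleSpace hV (hPo i) hW
      (hu.mono (hPΩ i)) (fun x hx => hu1 x (hPΩ i hx))
      (hf.mono (inter_subset_right.trans subset_union_left)) (mapsTo_iff_image_subset.2 hSV)
    refine ⟨g, hg, hgf, fun V' hV' hfV' a ha ε hε hVa hPa x hx => ?_⟩
    have h1 : dist (g x : Y) p < 2 * ε + infDist p Ω := by
      refine hVmin V' hV' (mapsTo_iff_image_subset.1 hfV') (2 * ε) (by positivity)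
        (fun v hv => ?_) _ (hgV hx)
      linarith [dist_triangle_right (v : Y) p a, hVa v hv, hPa p hp]
    linarith [infDist_le_dist_of_mem (x := p) ha, hPa p hp, dist_triangle (g x : Y) p a]
  choose g hg hgf hgmin using hchoice
  let f₁ : Y → Ω := fun x => if h : ∃ i, x ∈ P i then g h.choose x else f x
  have hf₁P : ∀ i, ∀ x ∈ P i, f₁ x = g i x := by
    intro i x hx
    have h : ∃ i, x ∈ P i := ⟨i, hx⟩
    simp only [f₁, dif_pos h]
    rw [hdisj _ _ x h.choose_spec hx]
  have hf₁n : ∀ x, (∀ i, x ∉ P i) → f₁ x = f x := fun x hx => by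
    simp only [f₁]
    rw [dif_neg (by simpa using hx)]
  let W' : Set Y := Ωᶜ ∩ u ⁻¹' Iio (1 / 3)
  have hW' : IsOpen W' := hu.isOpen_inter_preimage hcl.isOpen_compl isOpen_Iio
  have hW'W : W' ⊆ W := fun x hx => by
    by_contra h
    have : u x < 1 / 3 := hx.2
    rw [hu1 x hx.1 h] at this
    norm_num at this
  have hf₁W' : EqOn f₁ f W' := fun x hx => by
    by_cases h : ∃ i, x ∈ P i
    · obtain ⟨i, hi⟩ := h
      rw [hf₁P i x hi, hgf i x hi (le_of_lt hx.2)]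
    · exact hf₁n x (by simpa using h)
  have hid₁ : ∀ a : Ω, f₁ a = a := fun a => by
    rw [hf₁n a fun i hi => hPΩ i hi a.2, hid]
  refine ⟨W' ∪ ⋃ i, P i, f₁, hW'.union (isOpen_iUnion hPo), fun x hx => ?_, ?_, hid₁⟩
  · by_cases hxG : x ∈ (⋃ i, P i) ∪ R
    · exact hxG.elim (fun h => Or.inl (Or.inr h)) Or.inr
    · exact Or.inl (Or.inl ⟨hx, by rw [mem_preimage, hu0 x hx hxG, mem_Iio]; norm_num⟩)
  · rintro x ((hx | hx) | hx)
    · refine ContinuousAt.continuousWithinAt ?_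
      refine ContinuousAt.congr (f := f) ?_ ?_
      · exact hf.continuousAt (Filter.mem_of_superset (hW.mem_nhds (hW'W hx)) subset_union_left)
      · filter_upwards [hW'.mem_nhds hx] with y hy using (hf₁W' hy).symm
    · obtain ⟨i, hi⟩ := mem_iUnion.1 hx
      refine ContinuousAt.continuousWithinAt (ContinuousAt.congr (f := g i) ?_ ?_)
      · exact (hg i).continuousAt ((hPo i).mem_nhds hi)
      · filter_upwards [(hPo i).mem_nhds hi] with y hy using (hf₁P i y hy).symm
    · have hfx : f x = ⟨x, hx⟩ := hid ⟨x, hx⟩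
      have hf₁x : f₁ x = ⟨x, hx⟩ := hid₁ ⟨x, hx⟩
      rw [Metric.continuousWithinAt_iff]
      intro ε hε
      obtain ⟨V, hVo, hxV, hVball, hV⟩ := hslc ⟨x, hx⟩ (ball ⟨x, hx⟩ (ε / 4)) isOpen_ball
        (mem_ball_self (by positivity))
      have hcx := hf x (Or.inr hx)
      obtain ⟨δ₁, hδ₁, hδ₁V⟩ := Metric.mem_nhdsWithin_iff.1
        (hcx.preimage_mem_nhdsWithin (hVo.mem_nhds (hfx ▸ hxV)))
      obtain ⟨δ₂, hδ₂, hδ₂f⟩ := Metric.continuousWithinAt_iff.1 hcx ε hε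
      obtain ⟨δ₃, hδ₃, hδ₃P⟩ := hsmall x hx (min δ₁ (ε / 4)) (by positivity)
      refine ⟨min δ₂ δ₃, by positivity, fun y hy hyx => ?_⟩
      by_cases h : ∃ i, y ∈ P i
      · obtain ⟨i, hi⟩ := h
        have hP := hδ₃P i y hi (hyx.trans_le (min_le_right _ _))
        rw [hf₁x, hf₁P i y hi, Subtype.dist_eq]
        have := hgmin i V hV
          (fun z hz => hδ₁V ⟨(hP z hz.1).trans_le (min_le_left _ _), Or.inl hz.2⟩) x hx (ε / 4)
          (by positivity) (fun v hv => hVball hv)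
          (fun z hz => (hP z hz).trans_le (min_le_right _ _)) y hi
        linarith
      · rw [hf₁n y (by simpa using h), hf₁x, ← hfx]
        refine hδ₂f ?_ (hyx.trans_le (min_le_left _ _))
        rcases hy with (hy | hy) | hy
        · exact Or.inl (hW'W hy)
        · exact absurd (mem_iUnion.1 hy) h
        · exact Or.inr hy

/-- A bounded closed contractible and locally contractible set is a retract of the whole space if
its complement has a Whitney type cover by finitely many disjoint families. -/
theorem exists_retraction_of_finite_cover {Y : Type*} [MetricSpace Y] {Ω : Set Y}
    (hcl : IsClosed Ω) (hb : Bornology.IsBounded Ω) (hcontr : ContractibleSpace Ω)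
    (hslc : ∀ x : Ω, ∀ U : Set Ω, IsOpen U → x ∈ U →
      ∃ V : Set Ω, IsOpen V ∧ x ∈ V ∧ V ⊆ U ∧ ContractibleSpace V)
    {κ ι : Type*} [Finite κ] {P : κ → ι → Set Y} (hPo : ∀ c i, IsOpen (P c i))
    (hdisj : ∀ c i j x, x ∈ P c i → x ∈ P c j → i = j) (hPΩ : ∀ c i, P c i ⊆ Ωᶜ)
    (hsmall : ∀ c, ∀ a ∈ Ω, ∀ ε > 0, ∃ δ > 0, ∀ i, ∀ x ∈ P c i, dist x a < δ →
      ∀ y ∈ P c i, dist y a < ε)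
    (hcov : ∀ x ∉ Ω, ∃ c i, x ∈ P c i) :
    ∃ r : Y → Ω, Continuous r ∧ ∀ a : Ω, r a = a := by
  classical
  have := Fintype.ofFinite κ
  have key : ∀ S : Finset κ, ∃ (W : Set Y) (f : Y → Ω), IsOpen W ∧
      Ωᶜ ⊆ W ∪ (⋃ c ∉ S, ⋃ i, P c i) ∧ ContinuousOn f (W ∪ Ω) ∧ ∀ a : Ω, f a = a := by
    intro S
    induction S using Finset.induction_on with
    | empty =>
      obtain ⟨x₀⟩ := (inferInstance : Nonempty Ω)
      refine ⟨∅, fun y => if h : y ∈ Ω then ⟨y, h⟩ else x₀, isOpen_empty, fun x hx => ?_, ?_,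
        fun a => by simp⟩
      · obtain ⟨c, i, hi⟩ := hcov x hx
        simp only [Finset.notMem_empty, not_false_eq_true, iUnion_true, empty_union, mem_iUnion]
        exact ⟨c, i, hi⟩
      · rw [empty_union, continuousOn_iff_continuous_domRestrict]
        convert continuous_id (X := Ω) using 1
        ext x
        simp
    | insert c S hc ih =>
      obtain ⟨W, f, hW, hWcov, hf, hid⟩ := ih
      refine exists_extension_of_disjoint_family hcl hb hcontr hslc (hPo c) (hdisj c) (hPΩ c)
        (hsmall c) hW (R := ⋃ c' ∉ insert c S, ⋃ i, P c' i) ?_ ?_ hf hid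
      · exact isOpen_iUnion fun c' => isOpen_iUnion fun _ => isOpen_iUnion (hPo c')
      · refine hWcov.trans (union_subset_union_right _ ?_)
        refine iUnion₂_subset fun c' hc' => ?_
        rcases eq_or_ne c' c with rfl | hne
        · exact subset_union_left
        · have hc'' : c' ∉ insert c S := by simp [hne, hc']
          exact fun x hx => Or.inr (mem_iUnion₂.2 ⟨c', hc'', hx⟩)
  obtain ⟨W, f, -, hcovW, hf, hid⟩ := key Finset.univ
  refine ⟨f, ?_, hid⟩
  rw [← continuousOn_univ]
  refine hf.mono fun x _ => ?_
  by_cases hx : x ∈ Ω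
  · exact Or.inr hx
  · refine Or.inl ((hcovW hx).resolve_right fun h => ?_)
    obtain ⟨c, hc, -⟩ := mem_iUnion₂.1 h
    exact hc (Finset.mem_univ c)

/-- The dyadic cube `k` at scale `2 ^ m`, restricted to the points at distance about `2 ^ m`
from `Ω`. -/
def whitneyPiece {n : ℕ} (Ω : Set (Euc n)) (m : ℤ) (k : Fin n → ℤ) : Set (Euc n) :=
  {x | (2 : ℝ) ^ m < infDist x Ω ∧ infDist x Ω < 2 ^ (m + 2) ∧
    ∀ j, |x j - k j * 2 ^ m| < 2 ^ m}

theorem isOpen_whitneyPiece {n : ℕ} (Ω : Set (Euc n)) (m : ℤ) (k : Fin n → ℤ) :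
    IsOpen (whitneyPiece Ω m k) := by
  have h : whitneyPiece Ω m k = {x | (2 : ℝ) ^ m < infDist x Ω} ∩
      ({x | infDist x Ω < 2 ^ (m + 2)} ∩ ⋂ j, {x | |x j - k j * 2 ^ m| < 2 ^ m}) := by
    ext x
    simp [whitneyPiece]
  have hd := continuous_infDist_pt Ω
  rw [h]
  exact (isOpen_lt continuous_const hd).inter ((isOpen_lt hd continuous_const).inter
    (isOpen_iInter_of_finite fun j => isOpen_lt (by fun_prop) continuous_const))

theorem exists_mem_whitneyPiece {n : ℕ} {Ω : Set (Euc n)} (hcl : IsClosed Ω) (hne : Ω.Nonempty)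
    {x : Euc n} (hx : x ∉ Ω) : ∃ m k, x ∈ whitneyPiece Ω m k := by
  have hd : 0 < infDist x Ω := (hcl.notMem_iff_infDist_pos hne).1 hx
  obtain ⟨m, hm1, hm2⟩ := exists_mem_Ico_zpow hd one_lt_two
  have hpos : (0 : ℝ) < 2 ^ (m - 1) := by positivity
  refine ⟨m - 1, fun j => round (x j / 2 ^ (m - 1)), ?_, ?_, fun j => ?_⟩
  · exact (zpow_lt_zpow_right₀ one_lt_two (by omega)).trans_le hm1
  · rwa [show m - 1 + 2 = m + 1 by ring]
  · have h := abs_sub_round (x j / 2 ^ (m - 1))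
    have h2 : x j - round (x j / 2 ^ (m - 1)) * 2 ^ (m - 1) =
        (x j / 2 ^ (m - 1) - round (x j / 2 ^ (m - 1))) * 2 ^ (m - 1) := by
      field_simp
    rw [h2, abs_mul, abs_of_pos hpos]
    nlinarith

theorem whitneyPiece_index_unique {n : ℕ} {Ω : Set (Euc n)} {m m' : ℤ} {k k' : Fin n → ℤ}
    (hm : (m : ZMod 2) = m') (hk : ∀ j, (k j : ZMod 2) = k' j) {x : Euc n}
    (hx : x ∈ whitneyPiece Ω m k) (hx' : x ∈ whitneyPiece Ω m' k') : m = m' ∧ k = k' := by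
  obtain ⟨h1, h2, h3⟩ := hx
  obtain ⟨h1', h2', h3'⟩ := hx'
  have e1 : m < m' + 2 := (zpow_lt_zpow_iff_right₀ (one_lt_two (α := ℝ))).1 (h1.trans h2')
  have e2 : m' < m + 2 := (zpow_lt_zpow_iff_right₀ (one_lt_two (α := ℝ))).1 (h1'.trans h2)
  have hmm : m = m' := by
    have := (ZMod.intCast_eq_intCast_iff_dvd_sub _ _ _).1 hm
    omega
  subst hmm
  refine ⟨rfl, funext fun j => ?_⟩
  have hpos : (0 : ℝ) < 2 ^ m := by positivity
  have a1 := abs_lt.1 (h3 j)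
  have a2 := abs_lt.1 (h3' j)
  have b1 : (k j : ℝ) < k' j + 2 := by
    by_contra h
    nlinarith
  have b2 : (k' j : ℝ) < k j + 2 := by
    by_contra h
    nlinarith
  have c1 : k j < k' j + 2 := by exact_mod_cast b1
  have c2 : k' j < k j + 2 := by exact_mod_cast b2
  have := (ZMod.intCast_eq_intCast_iff_dvd_sub _ _ _).1 (hk j)
  omega

theorem dist_le_of_mem_whitneyPiece {n : ℕ} {Ω : Set (Euc n)} {m : ℤ} {k : Fin n → ℤ}
    {x y : Euc n} (hx : x ∈ whitneyPiece Ω m k) (hy : y ∈ whitneyPiece Ω m k) :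
    dist x y ≤ 2 * n * infDist x Ω := by
  have hcoord : ∀ j, dist (x j) (y j) ≤ 2 * infDist x Ω := by
    intro j
    have h1 := abs_lt.1 (hx.2.2 j)
    have h2 := abs_lt.1 (hy.2.2 j)
    have h3 := hx.1
    rw [Real.dist_eq, abs_le]
    constructor <;> linarith
  rw [EuclideanSpace.dist_eq]
  calc _ ≤ √((∑ j, dist (x j) (y j)) ^ 2) :=
        Real.sqrt_le_sqrt (Finset.sum_sq_le_sq_sum_of_nonneg fun _ _ => dist_nonneg)
    _ = ∑ j, dist (x j) (y j) := Real.sqrt_sq (Finset.sum_nonneg fun _ _ => dist_nonneg)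
    _ ≤ ∑ _j : Fin n, 2 * infDist x Ω := Finset.sum_le_sum fun j _ => hcoord j
    _ = 2 * n * infDist x Ω := by simp; ring

theorem StrictlyLocallyContractible.exists_retraction {n : ℕ} {Ω : Set (Euc n)}
    (hslc : StrictlyLocallyContractible Ω) (hcomp : IsCompact Ω) (hcontr : ContractibleSpace Ω) :
    ∃ r : Euc n → Ω, Continuous r ∧ ∀ a : Ω, r a = a := by
  have hne : Ω.Nonempty := by
    obtain ⟨x⟩ := (inferInstance : Nonempty Ω)
    exact ⟨x, x.2⟩
  let P : ZMod 2 × (Fin n → ZMod 2) → ℤ × (Fin n → ℤ) → Set (Euc n) := fun c i =>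
    {x | ((i.1 : ZMod 2) = c.1 ∧ ∀ j, (i.2 j : ZMod 2) = c.2 j) ∧ x ∈ whitneyPiece Ω i.1 i.2}
  refine exists_retraction_of_finite_cover hcomp.isClosed hcomp.isBounded hcontr hslc (P := P)
    (fun c i => isOpen_const.inter (isOpen_whitneyPiece Ω i.1 i.2)) ?_ ?_ ?_ ?_
  · rintro c ⟨m, k⟩ ⟨m', k'⟩ x ⟨⟨h1, h2⟩, hx⟩ ⟨⟨h1', h2'⟩, hx'⟩
    obtain ⟨rfl, rfl⟩ := whitneyPiece_index_unique (h1.trans h1'.symm)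
      (fun j => (h2 j).trans (h2' j).symm) hx hx'
    rfl
  · rintro c ⟨m, k⟩ x ⟨-, hx⟩ hxΩ
    have h1 := hx.1
    rw [infDist_zero_of_mem hxΩ] at h1
    exact absurd h1 (not_lt.2 (by positivity))
  · intro c a ha ε hε
    refine ⟨ε / (2 * n + 1), by positivity, fun i x hx hxa y hy => ?_⟩
    have h1 := dist_le_of_mem_whitneyPiece hx.2 hy.2
    have h2 : infDist x Ω ≤ dist x a := infDist_le_dist_of_mem ha
    rw [lt_div_iff₀ (by positivity)] at hxa
    have h3 : 2 * n * infDist x Ω ≤ 2 * n * dist x a := by gcongr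
    linarith [dist_triangle_left y a x]
  · intro x hx
    obtain ⟨m, k, h⟩ := exists_mem_whitneyPiece hcomp.isClosed hne hx
    exact ⟨(m, fun j => k j), (m, k), ⟨rfl, fun _ => rfl⟩, h⟩

theorem stmt8 (n : ℕ) (Ω : Set (Euc n)) (hcomp : IsCompact Ω)
    (hcontr : ContractibleSpace Ω)
    (hslc : StrictlyLocallyContractible Ω) :
    (∃ (z : Euc n) (R : ℝ), 0 < R ∧ Ω ⊆ Metric.closedBall z R ∧
      ∃ r : Metric.closedBall z R → Ω, Continuous r ∧
        ∀ x : Metric.closedBall z R, (x : Euc n) ∈ Ω → ((r x : Ω) : Euc n) = (x : Euc n)) ∧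
    ∀ f : Ω → Ω, Continuous f → ∃ x : Ω, f x = x := by
  obtain ⟨r, hr, hid⟩ := hslc.exists_retraction hcomp hcontr
  obtain ⟨R, hR0, hR⟩ := hcomp.isBounded.subset_closedBall_lt 0 0
  refine ⟨⟨0, R, hR0, hR, fun x => r x, hr.comp continuous_subtype_val, fun x hx => ?_⟩,
    fun f hf => ?_⟩
  · exact congrArg Subtype.val (hid ⟨x, hx⟩)
  · obtain ⟨x, hx⟩ := exists_fixedPoint_of_continuous_of_bounded
      (g := fun x : Euc n => (f (r x) : Euc n))
      (continuous_subtype_val.comp (hf.comp hr)) (R := R)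
      (fun x => by simpa using hR (f (r x)).2)
    have hxr : r x = f (r x) := by
      conv_lhs => rw [← hx]
      exact hid _
    exact ⟨r x, hxr.symm⟩
end
end

section
/- Fix M ≥ 1 and let Ω = {T ∈ SPD_N : T_max/T_min ≤ M}, where T_max, T_min denote the largest and smallest eigenvalues. For every S, T ∈ Ω and t ∈ [0,1], the matrix S_t = T^{t/2} S^{1−t} T^{t/2} is positive-definite with det S_t = 1 and satisfies (S_t)_max/(S_t)_min ≤ (T_max/T_min)^t (S_max/S_min)^{1−t} ≤ M, i.e. S_t ∈ Ω. Consequently Ω is compact and contractible. -/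
open Set

noncomputable section

/-- Fractional power of a positive-definite (more generally, Hermitian) matrix,
defined by functional calculus (junk value otherwise). -/
def mpow {N : ℕ} (T : Matrix (Fin N) (Fin N) ℝ) (s : ℝ) : Matrix (Fin N) (Fin N) ℝ :=
  if h : T.IsHermitian then h.cfc (fun x => x ^ s) else T

/-- Largest eigenvalue. -/
def eigMax {N : ℕ} (T : Matrix (Fin N) (Fin N) ℝ) : ℝ := sSup (spectrum ℝ T)

/-- Smallest eigenvalue. -/
def eigMin {N : ℕ} (T : Matrix (Fin N) (Fin N) ℝ) : ℝ := sInf (spectrum ℝ T)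

/-- `Ω = {T ∈ SPD_N : T_max / T_min ≤ M}`. -/
def OmegaSet (N : ℕ) (M : ℝ) : Set (Matrix (Fin N) (Fin N) ℝ) :=
  {T | T.PosDef ∧ T.det = 1 ∧ eigMax T / eigMin T ≤ M}

section SpectralForm

open Matrix

variable {N : ℕ}

/-- The symmetric matrix `U diag(d) U*`. -/
def spectralForm (U : Matrix (Fin N) (Fin N) ℝ) (d : Fin N → ℝ) : Matrix (Fin N) (Fin N) ℝ :=
  U * diagonal d * star U

theorem exists_spectralForm_eq {A : Matrix (Fin N) (Fin N) ℝ} (hA : A.IsHermitian) :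
    A = spectralForm hA.eigenvectorUnitary hA.eigenvalues := by
  conv_lhs => rw [hA.spectral_theorem, Unitary.conjStarAlgAut_apply]
  rfl

theorem isHermitian_spectralForm (U : Matrix (Fin N) (Fin N) ℝ) (d : Fin N → ℝ) :
    (spectralForm U d).IsHermitian :=
  isHermitian_mul_mul_conjTranspose U (isHermitian_diagonal d)

theorem posDef_spectralForm {U : Matrix (Fin N) (Fin N) ℝ} (hU : U ∈ unitaryGroup (Fin N) ℝ)
    {d : Fin N → ℝ} : (spectralForm U d).PosDef ↔ ∀ i, 0 < d i := by
  rw [spectralForm, IsUnit.posDef_star_right_conjugate_iff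
    (Unitary.isUnit_coe (U := (⟨U, hU⟩ : unitaryGroup (Fin N) ℝ))), posDef_diagonal_iff]

theorem posSemidef_spectralForm {U : Matrix (Fin N) (Fin N) ℝ}
    (hU : U ∈ unitaryGroup (Fin N) ℝ) {d : Fin N → ℝ} :
    (spectralForm U d).PosSemidef ↔ ∀ i, 0 ≤ d i := by
  rw [spectralForm, IsUnit.posSemidef_star_right_conjugate_iff
    (Unitary.isUnit_coe (U := (⟨U, hU⟩ : unitaryGroup (Fin N) ℝ))), posSemidef_diagonal_iff]

theorem spectrum_spectralForm {U : Matrix (Fin N) (Fin N) ℝ}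
    (hU : U ∈ unitaryGroup (Fin N) ℝ) (d : Fin N → ℝ) :
    spectrum ℝ (spectralForm U d) = Set.range d := by
  rw [spectralForm]
  exact (Unitary.spectrum_star_right_conjugate (U := (⟨U, hU⟩ : unitaryGroup (Fin N) ℝ))).trans
    (spectrum_diagonal d)

theorem det_spectralForm {U : Matrix (Fin N) (Fin N) ℝ} (hU : U ∈ unitaryGroup (Fin N) ℝ)
    (d : Fin N → ℝ) : (spectralForm U d).det = ∏ i, d i := by
  rw [spectralForm, det_mul_right_comm, mem_unitaryGroup_iff.1 hU, one_mul, det_diagonal]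

theorem spectralForm_mul {U : Matrix (Fin N) (Fin N) ℝ} (hU : U ∈ unitaryGroup (Fin N) ℝ)
    (d e : Fin N → ℝ) : spectralForm U d * spectralForm U e = spectralForm U (d * e) := by
  have h := mem_unitaryGroup_iff'.1 hU
  calc U * diagonal d * star U * (U * diagonal e * star U)
      = U * diagonal d * (star U * U) * diagonal e * star U := by simp only [mul_assoc]
    _ = U * (diagonal d * diagonal e) * star U := by rw [h]; simp only [mul_one, mul_assoc]
    _ = _ := by rw [diagonal_mul_diagonal]; rfl

theorem spectralForm_const {U : Matrix (Fin N) (Fin N) ℝ} (hU : U ∈ unitaryGroup (Fin N) ℝ)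
    (c : ℝ) : spectralForm U (fun _ => c) = c • 1 := by
  rw [spectralForm, ← smul_one_eq_diagonal, mul_smul_comm, mul_one, smul_mul_assoc,
    mem_unitaryGroup_iff.1 hU]

theorem spectralForm_sub (U : Matrix (Fin N) (Fin N) ℝ) (d e : Fin N → ℝ) :
    spectralForm U d - spectralForm U e = spectralForm U (d - e) := by
  rw [spectralForm, spectralForm, spectralForm, ← sub_mul, ← mul_sub, diagonal_sub]
  rfl

theorem posSemidef_smul_one_sub_spectralForm {U : Matrix (Fin N) (Fin N) ℝ}
    (hU : U ∈ unitaryGroup (Fin N) ℝ) {d : Fin N → ℝ} {c : ℝ} :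
    (c • 1 - spectralForm U d).PosSemidef ↔ ∀ i, d i ≤ c := by
  rw [← spectralForm_const hU, spectralForm_sub, posSemidef_spectralForm hU]
  simp

theorem posSemidef_spectralForm_sub_smul_one {U : Matrix (Fin N) (Fin N) ℝ}
    (hU : U ∈ unitaryGroup (Fin N) ℝ) {d : Fin N → ℝ} {c : ℝ} :
    (spectralForm U d - c • 1).PosSemidef ↔ ∀ i, c ≤ d i := by
  rw [← spectralForm_const hU, spectralForm_sub, posSemidef_spectralForm hU]
  simp

/-- A function of a symmetric matrix may be computed in any orthogonal diagonalization. -/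
theorem spectralForm_comp_eq {U V : Matrix (Fin N) (Fin N) ℝ} (hU : U ∈ unitaryGroup (Fin N) ℝ)
    (hV : V ∈ unitaryGroup (Fin N) ℝ) {d e : Fin N → ℝ}
    (h : spectralForm U d = spectralForm V e) (f : ℝ → ℝ) :
    spectralForm U (f ∘ d) = spectralForm V (f ∘ e) := by
  have hU₁ := mem_unitaryGroup_iff'.1 hU
  have hU₂ := mem_unitaryGroup_iff.1 hU
  have hV₁ := mem_unitaryGroup_iff'.1 hV
  have hV₂ := mem_unitaryGroup_iff.1 hV
  have key : diagonal d * (star U * V) = (star U * V) * diagonal e := by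
    calc diagonal d * (star U * V)
        = star U * U * diagonal d * star U * V := by rw [hU₁, one_mul, mul_assoc]
      _ = star U * spectralForm U d * V := by simp only [spectralForm, mul_assoc]
      _ = star U * V * diagonal e * (star V * V) := by
        rw [h]; simp only [spectralForm, mul_assoc]
      _ = _ := by rw [hV₁, mul_one]
  have key' : diagonal (f ∘ d) * (star U * V) = (star U * V) * diagonal (f ∘ e) := by
    ext i j
    have hij := congrFun (congrFun key i) j
    rw [diagonal_mul, mul_diagonal] at hij ⊢
    rw [mul_comm, mul_eq_mul_left_iff] at hij
    rcases hij with hij | hij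
    · simp only [Function.comp_apply, hij, mul_comm]
    · simp only [hij, mul_zero, zero_mul]
  calc spectralForm U (f ∘ d)
      = U * diagonal (f ∘ d) * star U * (V * star V) := by rw [hV₂, mul_one, spectralForm]
    _ = U * (diagonal (f ∘ d) * (star U * V)) * star V := by simp only [mul_assoc]
    _ = U * star U * V * diagonal (f ∘ e) * star V := by rw [key']; simp only [mul_assoc]
    _ = _ := by rw [hU₂, one_mul, spectralForm]

theorem mpow_spectralForm {U : Matrix (Fin N) (Fin N) ℝ} (hU : U ∈ unitaryGroup (Fin N) ℝ)
    (d : Fin N → ℝ) (s : ℝ) :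
    mpow (spectralForm U d) s = spectralForm U (fun i => d i ^ s) := by
  have hH := isHermitian_spectralForm U d
  rw [mpow, dif_pos hH, Matrix.IsHermitian.cfc, Unitary.conjStarAlgAut_apply]
  exact (spectralForm_comp_eq hU hH.eigenvectorUnitary.2 (exists_spectralForm_eq hH)
    (fun x => x ^ s)).symm

theorem sSup_range_div_sInf_range_le_iff {d : Fin N → ℝ} (hd : ∀ i, 0 < d i) {c : ℝ}
    (hc : 0 ≤ c) :
    sSup (Set.range d) / sInf (Set.range d) ≤ c ↔ ∀ i j, d i ≤ c * d j := by
  rcases isEmpty_or_nonempty (Fin N) with hN | hN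
  · simp [Set.range_eq_empty, hc]
  have hfin : (Set.range d).Finite := Set.finite_range d
  have hne : (Set.range d).Nonempty := Set.range_nonempty d
  obtain ⟨a, ha⟩ := hne.csSup_mem hfin
  obtain ⟨b, hb⟩ := hne.csInf_mem hfin
  rw [← hb, ← ha, div_le_iff₀ (hd b)]
  constructor
  · intro h i j
    calc d i ≤ d a := ha ▸ le_csSup hfin.bddAbove ⟨i, rfl⟩
      _ ≤ c * d b := h
      _ ≤ c * d j := by
        gcongr
        exact hb ▸ csInf_le hfin.bddBelow ⟨j, rfl⟩
  · exact fun h => h a b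

theorem spectralForm_mem_OmegaSet_iff {U : Matrix (Fin N) (Fin N) ℝ}
    (hU : U ∈ unitaryGroup (Fin N) ℝ) {d : Fin N → ℝ} {M : ℝ} (hM : 0 ≤ M) :
    spectralForm U d ∈ OmegaSet N M ↔
      (∀ i, 0 < d i) ∧ ∏ i, d i = 1 ∧ ∀ i j, d i ≤ M * d j := by
  rw [OmegaSet, Set.mem_ofPred_eq, posDef_spectralForm hU, det_spectralForm hU, eigMax, eigMin,
    spectrum_spectralForm hU]
  exact and_congr_right fun hd => and_congr_right fun _ =>
    sSup_range_div_sInf_range_le_iff hd hM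

/-- Eigenvalue lists of the elements of `OmegaSet N M`; the first condition is implied by the
others together with positivity, but makes compactness evident. -/
def eigenvalueSet (N : ℕ) (M : ℝ) : Set (Fin N → ℝ) :=
  {d | (∀ i, d i ∈ Set.Icc M⁻¹ M) ∧ ∏ i, d i = 1 ∧ ∀ i j, d i ≤ M * d j}

theorem isCompact_eigenvalueSet (N : ℕ) (M : ℝ) : IsCompact (eigenvalueSet N M) := by
  refine (isCompact_univ_pi fun _ : Fin N => isCompact_Icc (a := M⁻¹) (b := M)).of_isClosed_subset
    ?_ fun d hd i _ => hd.1 i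
  simp only [eigenvalueSet, Set.ofPred_and, Set.ofPred_forall]
  refine ((isClosed_iInter fun i => isClosed_Icc.preimage (continuous_apply i)).inter
    ((isClosed_eq (by fun_prop) (by fun_prop)).inter ?_))
  exact isClosed_iInter fun i => isClosed_iInter fun j => isClosed_le (by fun_prop) (by fun_prop)

theorem mem_eigenvalueSet {d : Fin N → ℝ} {M : ℝ} (hM : 1 ≤ M) (hd : ∀ i, 0 < d i)
    (hprod : ∏ i, d i = 1) (h : ∀ i j, d i ≤ M * d j) : d ∈ eigenvalueSet N M := by
  refine ⟨fun i => ⟨?_, ?_⟩, hprod, h⟩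
  · have : ∃ j, 1 ≤ d j := by
      by_contra! hlt
      have := Finset.prod_lt_prod_of_nonempty (f := d) (g := fun _ => 1) (s := Finset.univ)
        (fun i _ => hd i) (fun i _ => hlt i) ⟨i, Finset.mem_univ i⟩
      simp [hprod] at this
    obtain ⟨j, hj⟩ := this
    rw [inv_le_iff_one_le_mul₀ (by linarith), mul_comm]
    exact hj.trans (h j i)
  · have : ∃ j, d j ≤ 1 := by
      by_contra! hlt
      have := Finset.prod_lt_prod_of_nonempty (f := fun _ => 1) (g := d) (s := Finset.univ)
        (fun i _ => one_pos) (fun i _ => hlt i) ⟨i, Finset.mem_univ i⟩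
      simp [hprod] at this
    obtain ⟨j, hj⟩ := this
    have := h i j
    nlinarith

theorem isCompact_unitaryGroup (N : ℕ) :
    IsCompact (unitaryGroup (Fin N) ℝ : Set (Matrix (Fin N) (Fin N) ℝ)) := by
  have hbox : IsCompact (Set.univ.pi fun _ : Fin N => Set.univ.pi fun _ : Fin N =>
      Set.Icc (-1 : ℝ) 1) :=
    isCompact_univ_pi fun _ => isCompact_univ_pi fun _ => isCompact_Icc
  refine hbox.of_isClosed_subset ?_ fun U hU i _ j _ =>
    abs_le.1 (entry_norm_bound_of_unitary hU i j)
  have : (unitaryGroup (Fin N) ℝ : Set (Matrix (Fin N) (Fin N) ℝ)) = {U | U * star U = 1} :=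
    Set.ext fun U => mem_unitaryGroup_iff
  rw [this]
  exact isClosed_eq (by fun_prop) (by fun_prop)

theorem exists_diagonalization_of_mem_OmegaSet {M : ℝ} (hM : 1 ≤ M)
    {T : Matrix (Fin N) (Fin N) ℝ} (hT : T ∈ OmegaSet N M) :
    ∃ U ∈ unitaryGroup (Fin N) ℝ, ∃ d ∈ eigenvalueSet N M, spectralForm U d = T := by
  have hT' := exists_spectralForm_eq hT.1.1
  have hU := hT.1.1.eigenvectorUnitary.2
  rw [hT', spectralForm_mem_OmegaSet_iff hU (by linarith)] at hT
  exact ⟨_, hU, _, mem_eigenvalueSet hM hT.1 hT.2.1 hT.2.2, hT'.symm⟩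

theorem eigenvalueSet_pos {M : ℝ} (hM : 1 ≤ M) {d : Fin N → ℝ} (hd : d ∈ eigenvalueSet N M)
    (i : Fin N) : 0 < d i :=
  (inv_pos.2 (by linarith)).trans_le (hd.1 i).1

theorem spectralForm_mem_OmegaSet {M : ℝ} (hM : 1 ≤ M) {U : Matrix (Fin N) (Fin N) ℝ}
    (hU : U ∈ unitaryGroup (Fin N) ℝ) {d : Fin N → ℝ} (hd : d ∈ eigenvalueSet N M) :
    spectralForm U d ∈ OmegaSet N M :=
  (spectralForm_mem_OmegaSet_iff hU (by linarith)).2 ⟨eigenvalueSet_pos hM hd, hd.2⟩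

theorem continuous_spectralForm :
    Continuous fun p : Matrix (Fin N) (Fin N) ℝ × (Fin N → ℝ) => spectralForm p.1 p.2 := by
  unfold spectralForm
  fun_prop

/-- Orthogonal diagonalizations of the elements of `OmegaSet N M`. -/
def diagonalizationSet (N : ℕ) (M : ℝ) : Set (Matrix (Fin N) (Fin N) ℝ × (Fin N → ℝ)) :=
  (unitaryGroup (Fin N) ℝ : Set (Matrix (Fin N) (Fin N) ℝ)) ×ˢ eigenvalueSet N M

/-- The matrix with a given orthogonal diagonalization. -/
def undiagonalize {M : ℝ} (hM : 1 ≤ M) (k : diagonalizationSet N M) : OmegaSet N M :=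
  ⟨spectralForm k.1.1 k.1.2, spectralForm_mem_OmegaSet hM k.2.1 k.2.2⟩

theorem continuous_undiagonalize {M : ℝ} (hM : 1 ≤ M) :
    Continuous (undiagonalize hM : diagonalizationSet N M → OmegaSet N M) :=
  (continuous_spectralForm.comp continuous_subtype_val).subtype_mk _

theorem surjective_undiagonalize {M : ℝ} (hM : 1 ≤ M) :
    Function.Surjective (undiagonalize hM : diagonalizationSet N M → OmegaSet N M) := by
  rintro ⟨T, hT⟩
  obtain ⟨U, hU, d, hd, h⟩ := exists_diagonalization_of_mem_OmegaSet hM hT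
  exact ⟨⟨(U, d), hU, hd⟩, Subtype.ext h⟩

instance compactSpace_diagonalizationSet (N : ℕ) (M : ℝ) :
    CompactSpace (diagonalizationSet N M) :=
  isCompact_iff_compactSpace.1 ((isCompact_unitaryGroup N).prod (isCompact_eigenvalueSet N M))

theorem isCompact_OmegaSet {M : ℝ} (hM : 1 ≤ M) : IsCompact (OmegaSet N M) :=
  isCompact_iff_compactSpace.2
    ((surjective_undiagonalize hM).compactSpace (continuous_undiagonalize hM))

instance t2Space_OmegaSet (N : ℕ) (M : ℝ) : T2Space (OmegaSet N M) :=
  have : T2Space (Matrix (Fin N) (Fin N) ℝ) := inferInstanceAs (T2Space (Fin N → Fin N → ℝ))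
  inferInstance

theorem isQuotientMap_undiagonalize {M : ℝ} (hM : 1 ≤ M) :
    Topology.IsQuotientMap (Prod.map id (undiagonalize hM) :
      unitInterval × diagonalizationSet N M → unitInterval × OmegaSet N M) :=
  .of_surjective_continuous (Function.surjective_id.prodMap (surjective_undiagonalize hM))
    (continuous_id.prodMap (continuous_undiagonalize hM))

/-- Real powers depend jointly continuously on the matrix and the exponent. -/
theorem continuous_mpow_OmegaSet {M : ℝ} (hM : 1 ≤ M) :
    Continuous fun p : unitInterval × OmegaSet N M =>
      mpow (p.2 : Matrix (Fin N) (Fin N) ℝ) (1 - p.1) := by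
  rw [(isQuotientMap_undiagonalize hM).continuous_iff]
  have hk : Continuous fun p : unitInterval × diagonalizationSet N M => p.2.1 :=
    continuous_subtype_val.comp continuous_snd
  have hpow : Continuous fun p : unitInterval × diagonalizationSet N M =>
      fun i => p.2.1.2 i ^ (1 - (p.1 : ℝ)) := by
    refine continuous_pi fun i => Continuous.rpow ?_ ?_ fun p =>
      Or.inl (eigenvalueSet_pos hM p.2.2.2 i).ne'
    · exact (continuous_apply i).comp (continuous_snd.comp hk)
    · exact continuous_const.sub (continuous_subtype_val.comp continuous_fst)
  have hcont : Continuous fun p : unitInterval × diagonalizationSet N M =>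
      spectralForm p.2.1.1 (fun i => p.2.1.2 i ^ (1 - (p.1 : ℝ))) :=
    continuous_spectralForm.comp ((continuous_fst.comp hk).prodMk hpow)
  exact hcont.congr fun p => (mpow_spectralForm p.2.2.1 _ _).symm

theorem rpow_mem_eigenvalueSet {M : ℝ} (hM : 1 ≤ M) {d : Fin N → ℝ}
    (hd : d ∈ eigenvalueSet N M) {s : ℝ} (hs : s ∈ Set.Icc (0 : ℝ) 1) :
    (fun i => d i ^ s) ∈ eigenvalueSet N M := by
  have hpos := eigenvalueSet_pos hM hd
  refine mem_eigenvalueSet hM (fun i => Real.rpow_pos_of_pos (hpos i) s) ?_ fun i j => ?_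
  · rw [Real.finsetProd_rpow _ _ fun i _ => (hpos i).le, hd.2.1, Real.one_rpow]
  · calc d i ^ s ≤ (M * d j) ^ s := Real.rpow_le_rpow (hpos i).le (hd.2.2 i j) hs.1
      _ = M ^ s * d j ^ s := Real.mul_rpow (by linarith) (hpos j).le
      _ ≤ M * d j ^ s := by
        gcongr
        · exact Real.rpow_nonneg (hpos j).le s
        · exact Real.rpow_le_self_of_one_le hM hs.2

theorem mpow_mem_OmegaSet {M : ℝ} (hM : 1 ≤ M) {T : Matrix (Fin N) (Fin N) ℝ}
    (hT : T ∈ OmegaSet N M) {s : ℝ} (hs : s ∈ Set.Icc (0 : ℝ) 1) : mpow T s ∈ OmegaSet N M := by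
  obtain ⟨U, hU, d, hd, rfl⟩ := exists_diagonalization_of_mem_OmegaSet hM hT
  rw [mpow_spectralForm hU]
  exact spectralForm_mem_OmegaSet hM hU (rpow_mem_eigenvalueSet hM hd hs)

theorem contractibleSpace_OmegaSet {M : ℝ} (hM : 1 ≤ M) : ContractibleSpace (OmegaSet N M) := by
  have hone : (1 : Matrix (Fin N) (Fin N) ℝ) ∈ OmegaSet N M := by
    have h := spectralForm_const (one_mem (unitaryGroup (Fin N) ℝ)) (1 : ℝ)
    rw [one_smul] at h
    rw [← h, spectralForm_mem_OmegaSet_iff (one_mem _) (by linarith)]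
    simpa using fun _ _ => hM
  rw [contractible_iff_id_nullhomotopic]
  refine ⟨⟨1, hone⟩, ⟨{
    toFun p := ⟨mpow p.2 (1 - p.1), mpow_mem_OmegaSet hM p.2.2
      ⟨sub_nonneg.2 p.1.2.2, sub_le_self 1 p.1.2.1⟩⟩
    continuous_toFun := (continuous_mpow_OmegaSet hM).subtype_mk _
    map_zero_left := ?_
    map_one_left := ?_ }⟩⟩
  all_goals
    rintro ⟨T, hT⟩
    obtain ⟨U, hU, d, hd, rfl⟩ := exists_diagonalization_of_mem_OmegaSet hM hT
    refine Subtype.ext ?_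
    simp [mpow_spectralForm hU, spectralForm_const hU]

/-- If `X² ≤ q` and `P ≤ p` then `X P X ≤ p q`. -/
theorem posSemidef_smul_one_sub_mul_mul {X P : Matrix (Fin N) (Fin N) ℝ} (hX : X.IsHermitian)
    {p q : ℝ} (hp : 0 ≤ p) (hP : (p • 1 - P).PosSemidef) (hXX : (q • 1 - X * X).PosSemidef) :
    ((p * q) • 1 - X * P * X).PosSemidef := by
  have h₁ := hP.mul_mul_conjTranspose_same X
  rw [hX.eq] at h₁
  convert (hXX.smul hp).add h₁ using 1
  simp only [mul_sub, sub_mul, smul_sub, mul_smul_comm, smul_mul_assoc, mul_one, smul_smul]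
  abel

/-- If `q ≤ X²` and `p ≤ P` then `p q ≤ X P X`. -/
theorem posSemidef_mul_mul_sub_smul_one {X P : Matrix (Fin N) (Fin N) ℝ} (hX : X.IsHermitian)
    {p q : ℝ} (hp : 0 ≤ p) (hP : (P - p • 1).PosSemidef) (hXX : (X * X - q • 1).PosSemidef) :
    (X * P * X - (p * q) • 1).PosSemidef := by
  have h₁ := hP.mul_mul_conjTranspose_same X
  rw [hX.eq] at h₁
  convert (hXX.smul hp).add h₁ using 1
  simp only [mul_sub, sub_mul, smul_sub, mul_smul_comm, smul_mul_assoc, mul_one, smul_smul]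
  abel

theorem eigMax_spectralForm {U : Matrix (Fin N) (Fin N) ℝ} (hU : U ∈ unitaryGroup (Fin N) ℝ)
    (d : Fin N → ℝ) : eigMax (spectralForm U d) = sSup (Set.range d) := by
  rw [eigMax, spectrum_spectralForm hU]

theorem eigMin_spectralForm {U : Matrix (Fin N) (Fin N) ℝ} (hU : U ∈ unitaryGroup (Fin N) ℝ)
    (d : Fin N → ℝ) : eigMin (spectralForm U d) = sInf (Set.range d) := by
  rw [eigMin, spectrum_spectralForm hU]

theorem eigMax_div_eigMin_nonneg {A : Matrix (Fin N) (Fin N) ℝ} (hA : A.PosDef) :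
    0 ≤ eigMax A / eigMin A := by
  have hpos : ∀ x ∈ spectrum ℝ A, 0 ≤ x := fun x hx => by
    rw [exists_spectralForm_eq hA.1, spectrum_spectralForm hA.1.eigenvectorUnitary.2] at hx
    obtain ⟨i, rfl⟩ := hx
    exact (hA.eigenvalues_pos i).le
  exact div_nonneg (Real.sSup_nonneg hpos) (Real.sInf_nonneg hpos)

theorem posDef_mpow {A : Matrix (Fin N) (Fin N) ℝ} (hA : A.PosDef) (s : ℝ) :
    (mpow A s).PosDef := by
  have hU := hA.1.eigenvectorUnitary.2
  rw [exists_spectralForm_eq hA.1, mpow_spectralForm hU, posDef_spectralForm hU]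
  exact fun i => Real.rpow_pos_of_pos (hA.eigenvalues_pos i) s

theorem det_mpow {A : Matrix (Fin N) (Fin N) ℝ} (hA : A.PosDef) (s : ℝ) :
    (mpow A s).det = A.det ^ s := by
  have hU := hA.1.eigenvectorUnitary.2
  rw [exists_spectralForm_eq hA.1, mpow_spectralForm hU, det_spectralForm hU,
    det_spectralForm hU, Real.finsetProd_rpow _ _ fun i _ => (hA.eigenvalues_pos i).le]

theorem mpow_mul_mpow {A : Matrix (Fin N) (Fin N) ℝ} (hA : A.PosDef) (s t : ℝ) :
    mpow A s * mpow A t = mpow A (s + t) := by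
  have hU := hA.1.eigenvectorUnitary.2
  rw [exists_spectralForm_eq hA.1, mpow_spectralForm hU, mpow_spectralForm hU,
    mpow_spectralForm hU, spectralForm_mul hU]
  congr 1
  ext i
  exact (Real.rpow_add (hA.eigenvalues_pos i) s t).symm

theorem posDef_mpow_mul_mpow_mul_mpow {S T : Matrix (Fin N) (Fin N) ℝ} (hS : S.PosDef)
    (hT : T.PosDef) (s t : ℝ) : (mpow T t * mpow S s * mpow T t).PosDef := by
  have hX := posDef_mpow hT t
  have h := (IsUnit.posDef_star_right_conjugate_iff (x := mpow S s) hX.isUnit).2 (posDef_mpow hS s)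
  rwa [star_eq_conjTranspose, hX.1.eq] at h

theorem posSemidef_eigMax_rpow_sub_mpow {A : Matrix (Fin N) (Fin N) ℝ} (hA : A.PosDef) {s : ℝ}
    (hs : 0 ≤ s) : (eigMax A ^ s • 1 - mpow A s).PosSemidef := by
  have hU := hA.1.eigenvectorUnitary.2
  rw [exists_spectralForm_eq hA.1, mpow_spectralForm hU, eigMax_spectralForm hU,
    posSemidef_smul_one_sub_spectralForm hU]
  exact fun i => Real.rpow_le_rpow (hA.eigenvalues_pos i).le
    (le_csSup (Set.finite_range _).bddAbove ⟨i, rfl⟩) hs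

theorem posSemidef_mpow_sub_eigMin_rpow {A : Matrix (Fin N) (Fin N) ℝ} (hA : A.PosDef) {s : ℝ}
    (hs : 0 ≤ s) : (mpow A s - eigMin A ^ s • 1).PosSemidef := by
  have hU := hA.1.eigenvectorUnitary.2
  rw [exists_spectralForm_eq hA.1, mpow_spectralForm hU, eigMin_spectralForm hU,
    posSemidef_spectralForm_sub_smul_one hU]
  refine fun i => Real.rpow_le_rpow (Real.sInf_nonneg ?_)
    (csInf_le (Set.finite_range _).bddBelow ⟨i, rfl⟩) hs
  rintro _ ⟨j, rfl⟩
  exact (hA.eigenvalues_pos j).le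

theorem eigMin_pos [Nonempty (Fin N)] {A : Matrix (Fin N) (Fin N) ℝ} (hA : A.PosDef) :
    0 < eigMin A := by
  have hU := hA.1.eigenvectorUnitary.2
  rw [exists_spectralForm_eq hA.1, eigMin_spectralForm hU]
  obtain ⟨i, hi⟩ := (Set.range_nonempty hA.1.eigenvalues).csInf_mem (Set.finite_range _)
  exact hi ▸ hA.eigenvalues_pos i

theorem eigMax_nonneg {A : Matrix (Fin N) (Fin N) ℝ} (hA : A.PosDef) : 0 ≤ eigMax A := by
  have hU := hA.1.eigenvectorUnitary.2
  rw [exists_spectralForm_eq hA.1, eigMax_spectralForm hU]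
  refine Real.sSup_nonneg ?_
  rintro _ ⟨j, rfl⟩
  exact (hA.eigenvalues_pos j).le

theorem eigMax_div_eigMin_mpow_mul_le {S T : Matrix (Fin N) (Fin N) ℝ} (hS : S.PosDef)
    (hT : T.PosDef) {t : ℝ} (ht : t ∈ Set.Icc (0 : ℝ) 1) :
    eigMax (mpow T (t / 2) * mpow S (1 - t) * mpow T (t / 2)) /
        eigMin (mpow T (t / 2) * mpow S (1 - t) * mpow T (t / 2)) ≤
      (eigMax T / eigMin T) ^ t * (eigMax S / eigMin S) ^ (1 - t) := by
  have hB := posDef_mpow_mul_mpow_mul_mpow hS hT (1 - t) (t / 2)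
  have hs : 0 ≤ 1 - t := sub_nonneg.2 ht.2
  have hX := (posDef_mpow hT (t / 2)).1
  have hXX : mpow T (t / 2) * mpow T (t / 2) = mpow T t := by
    rw [mpow_mul_mpow hT, add_halves]
  have hU := hB.1.eigenvectorUnitary.2
  have hBeq := exists_spectralForm_eq hB.1
  have hup := posSemidef_smul_one_sub_mul_mul hX (Real.rpow_nonneg (eigMax_nonneg hS) _)
    (posSemidef_eigMax_rpow_sub_mpow hS hs) (hXX ▸ posSemidef_eigMax_rpow_sub_mpow hT ht.1)
  rw [hBeq, posSemidef_smul_one_sub_spectralForm hU] at hup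
  rw [hBeq, eigMax_spectralForm hU, eigMin_spectralForm hU,
    sSup_range_div_sInf_range_le_iff hB.eigenvalues_pos
      (mul_nonneg (Real.rpow_nonneg (eigMax_div_eigMin_nonneg hT) _)
        (Real.rpow_nonneg (eigMax_div_eigMin_nonneg hS) _))]
  intro i j
  have : Nonempty (Fin N) := ⟨i⟩
  have hSm := eigMin_pos hS
  have hTm := eigMin_pos hT
  have hlow := posSemidef_mul_mul_sub_smul_one hX (Real.rpow_nonneg hSm.le _)
    (posSemidef_mpow_sub_eigMin_rpow hS hs) (hXX ▸ posSemidef_mpow_sub_eigMin_rpow hT ht.1)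
  rw [hBeq, posSemidef_spectralForm_sub_smul_one hU] at hlow
  have hSm' := Real.rpow_pos_of_pos hSm (1 - t)
  have hTm' := Real.rpow_pos_of_pos hTm t
  have hSM := Real.rpow_nonneg (eigMax_nonneg hS) (1 - t)
  have hTM := Real.rpow_nonneg (eigMax_nonneg hT) t
  rw [Real.div_rpow (eigMax_nonneg hT) hTm.le, Real.div_rpow (eigMax_nonneg hS) hSm.le]
  calc _ ≤ eigMax S ^ (1 - t) * eigMax T ^ t := hup i
    _ = eigMax T ^ t / eigMin T ^ t * (eigMax S ^ (1 - t) / eigMin S ^ (1 - t)) *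
        (eigMin S ^ (1 - t) * eigMin T ^ t) := by field_simp
    _ ≤ _ := by
      gcongr
      exact hlow j

end SpectralForm

theorem stmt17 (N : ℕ) (M : ℝ) (hM : 1 ≤ M) :
    (∀ S ∈ OmegaSet N M, ∀ T ∈ OmegaSet N M, ∀ t : ℝ, t ∈ Set.Icc (0 : ℝ) 1 →
      (mpow T (t / 2) * mpow S (1 - t) * mpow T (t / 2)).PosDef ∧
      (mpow T (t / 2) * mpow S (1 - t) * mpow T (t / 2)).det = 1 ∧
      eigMax (mpow T (t / 2) * mpow S (1 - t) * mpow T (t / 2)) /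
          eigMin (mpow T (t / 2) * mpow S (1 - t) * mpow T (t / 2)) ≤
        (eigMax T / eigMin T) ^ t * (eigMax S / eigMin S) ^ (1 - t) ∧
      (eigMax T / eigMin T) ^ t * (eigMax S / eigMin S) ^ (1 - t) ≤ M ∧
      mpow T (t / 2) * mpow S (1 - t) * mpow T (t / 2) ∈ OmegaSet N M) ∧
    IsCompact (OmegaSet N M) ∧ ContractibleSpace (OmegaSet N M) := by
  refine ⟨fun S hS T hT t ht => ?_, isCompact_OmegaSet hM, contractibleSpace_OmegaSet hM⟩
  have hpos := posDef_mpow_mul_mpow_mul_mpow hS.1 hT.1 (1 - t) (t / 2)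
  have hdet : (mpow T (t / 2) * mpow S (1 - t) * mpow T (t / 2)).det = 1 := by
    simp [Matrix.det_mul, det_mpow hS.1, det_mpow hT.1, hS.2.1, hT.2.1]
  have hle := eigMax_div_eigMin_mpow_mul_le hS.1 hT.1 ht
  have hM₀ : 0 < M := by linarith
  have hbound : (eigMax T / eigMin T) ^ t * (eigMax S / eigMin S) ^ (1 - t) ≤ M := by
    calc (eigMax T / eigMin T) ^ t * (eigMax S / eigMin S) ^ (1 - t)
        ≤ M ^ t * M ^ (1 - t) :=
          mul_le_mul (Real.rpow_le_rpow (eigMax_div_eigMin_nonneg hT.1) hT.2.2 ht.1)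
            (Real.rpow_le_rpow (eigMax_div_eigMin_nonneg hS.1) hS.2.2 (sub_nonneg.2 ht.2))
            (Real.rpow_nonneg (eigMax_div_eigMin_nonneg hS.1) _) (Real.rpow_nonneg hM₀.le _)
      _ = M := by rw [← Real.rpow_add hM₀, add_sub_cancel, Real.rpow_one]
  exact ⟨hpos, hdet, hle, hbound, hpos, hdet, hle.trans hbound⟩
end
end
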